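/- (Rassias' theorem, negative exponent case) Let E be a real normed vector space, E' a real Banach space, ε > 0 and p < 0. Let f : E → E' satisfy ‖f(x+y) − f(x) − f(y)‖ ≤ ε(‖x‖^p + ‖y‖^p) for all nonzero x, y ∈ E. Then there exists a unique additive mapping T : E → E' such that ‖f(x) − T(x)‖ ≤ (2ε/(2 − 2^p))‖x‖^p for all nonzero x ∈ E. -/

import Mathlib

open Filter Topology

theorem tendsto_norm_add_natCast_smul_atTop {E : Type*} [NormedAddCommGroup E] [NormedSpace ℝ E]
    (v : E) {w : E} (hw : w ≠ 0) :
    Tendsto (fun n : ℕ => ‖v + (n : ℝ) • w‖) atTop atTop := by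
  have h : Tendsto (fun n : ℕ => (n : ℝ) * ‖w‖ - ‖v‖) atTop atTop :=
    tendsto_atTop_add_const_right _ _
      (tendsto_natCast_atTop_atTop.atTop_mul_const (norm_pos_iff.mpr hw))
  refine tendsto_atTop_mono (fun n => ?_) h
  have h1 := norm_sub_le (v + (n : ℝ) • w) v
  rw [add_sub_cancel_left, norm_smul, Real.norm_natCast] at h1
  linarith

theorem tendsto_norm_rpow_zero {E : Type*} [NormedAddCommGroup E] {p : ℝ} (hp : p < 0)
    {a : ℕ → E} (ha : Tendsto (fun n => ‖a n‖) atTop atTop) :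
    Tendsto (fun n => ‖a n‖ ^ p) atTop (𝓝 0) := by
  simpa [Function.comp_def] using (tendsto_rpow_neg_atTop (neg_pos.mpr hp)).comp ha

theorem eventually_ne_zero_of_tendsto_norm_atTop {E : Type*} [NormedAddCommGroup E]
    {a : ℕ → E} (ha : Tendsto (fun n => ‖a n‖) atTop atTop) : ∀ᶠ n in atTop, a n ≠ 0 :=
  (ha.eventually_gt_atTop 0).mono fun _ h => norm_pos_iff.mp h

/-- Hyperstability of the Cauchy equation: a Cauchy difference bounded by a negative power
of the norms vanishes identically. -/
theorem map_add_of_norm_cauchy_difference_le {E E' : Type*} [NormedAddCommGroup E]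
    [NormedSpace ℝ E] [Nontrivial E] [NormedAddCommGroup E'] {ε p : ℝ} (hp : p < 0) {f : E → E'}
    (hf : ∀ x y : E, x ≠ 0 → y ≠ 0 → ‖f (x + y) - f x - f y‖ ≤ ε * (‖x‖ ^ p + ‖y‖ ^ p))
    (x y : E) : f (x + y) = f x + f y := by
  obtain ⟨u, hu⟩ := exists_ne (0 : E)
  have hD : ∀ a b : ℕ → E, Tendsto (fun n => ‖a n‖) atTop atTop →
      Tendsto (fun n => ‖b n‖) atTop atTop →
      Tendsto (fun n => f (a n + b n) - f (a n) - f (b n)) atTop (𝓝 0) := by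
    intro a b ha hb
    refine squeeze_zero_norm' (a := fun n => ε * (‖a n‖ ^ p + ‖b n‖ ^ p)) ?_ ?_
    · filter_upwards [eventually_ne_zero_of_tendsto_norm_atTop ha,
        eventually_ne_zero_of_tendsto_norm_atTop hb] with n h1 h2 using hf _ _ h1 h2
    · simpa using
        ((tendsto_norm_rpow_zero hp ha).add (tendsto_norm_rpow_zero hp hb)).const_mul ε
  have hu2 : (2 : ℝ) • u ≠ 0 := smul_ne_zero two_ne_zero hu
  have ha := tendsto_norm_add_natCast_smul_atTop x hu
  have hb := tendsto_norm_add_natCast_smul_atTop y hu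
  have hc := tendsto_norm_add_natCast_smul_atTop 0 (neg_ne_zero.mpr hu)
  have hab := tendsto_norm_add_natCast_smul_atTop (x + y) hu2
  have hcc := tendsto_norm_add_natCast_smul_atTop 0 (neg_ne_zero.mpr hu2)
  have key := ((((hD _ _ hab hcc).add (hD _ _ ha hb)).add (hD _ _ hc hc)).sub
    (hD _ _ ha hc)).sub (hD _ _ hb hc)
  have hconst : Tendsto (fun _ : ℕ => f (x + y) - f x - f y) atTop (𝓝 0) := by
    convert key using 2 with n
    · rw [show x + y + (n : ℝ) • (2 : ℝ) • u + (0 + (n : ℝ) • -((2 : ℝ) • u)) = x + y by module,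
        show x + (n : ℝ) • u + (y + (n : ℝ) • u) = x + y + (n : ℝ) • (2 : ℝ) • u by module,
        show (0 : E) + (n : ℝ) • -u + (0 + (n : ℝ) • -u) = 0 + (n : ℝ) • -((2 : ℝ) • u) by module,
        show x + (n : ℝ) • u + (0 + (n : ℝ) • -u) = x by module,
        show y + (n : ℝ) • u + (0 + (n : ℝ) • -u) = y by module]
      abel
    · simp
  have h0 := tendsto_nhds_unique tendsto_const_nhds hconst
  rwa [sub_sub, sub_eq_zero] at h0

theorem eq_zero_of_map_add_of_norm_le_rpow {E E' : Type*} [NormedAddCommGroup E]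
    [NormedSpace ℝ E] [NormedAddCommGroup E'] {C p : ℝ} (hp : p < 0) {S : E → E'}
    (hadd : ∀ x y : E, S (x + y) = S x + S y) (hS : ∀ x : E, x ≠ 0 → ‖S x‖ ≤ C * ‖x‖ ^ p)
    (x : E) : S x = 0 := by
  rcases eq_or_ne x 0 with rfl | hx
  · simpa using hadd 0 0
  have hlim : ∀ v : E, Tendsto (fun n : ℕ => S (v + (n : ℝ) • x)) atTop (𝓝 0) := by
    intro v
    have hv := tendsto_norm_add_natCast_smul_atTop v hx
    refine squeeze_zero_norm' (a := fun n : ℕ => C * ‖v + (n : ℝ) • x‖ ^ p) ?_ ?_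
    · filter_upwards [eventually_ne_zero_of_tendsto_norm_atTop hv] with n h using hS _ h
    · simpa using (tendsto_norm_rpow_zero hp hv).const_mul C
  have h := (hlim x).sub (hlim 0)
  simp only [zero_add, hadd x, add_sub_cancel_right, sub_zero] at h
  exact tendsto_nhds_unique tendsto_const_nhds h

/-- Rassias' theorem, negative exponent case (`p < 0`), with the hypothesis and the
estimate holding for nonzero vectors. -/
theorem stmt_6 {E E' : Type*} [NormedAddCommGroup E] [NormedSpace ℝ E]
    [NormedAddCommGroup E'] [NormedSpace ℝ E'] [CompleteSpace E']
    (ε p : ℝ) (hε : 0 < ε) (hp : p < 0) (f : E → E')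
    (hf : ∀ x y : E, x ≠ 0 → y ≠ 0 → ‖f (x + y) - f x - f y‖ ≤ ε * (‖x‖ ^ p + ‖y‖ ^ p)) :
    ∃! T : E → E', (∀ x y : E, T (x + y) = T x + T y) ∧
      ∀ x : E, x ≠ 0 → ‖f x - T x‖ ≤ 2 * ε / (2 - 2 ^ p) * ‖x‖ ^ p := by
  rcases subsingleton_or_nontrivial E with hE | hE
  · refine ⟨0, ⟨by simp, fun x hx => absurd (Subsingleton.elim x 0) hx⟩, ?_⟩
    rintro T ⟨hT, -⟩
    funext x
    rw [Subsingleton.elim x 0]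
    simpa using hT 0 0
  · have hadd := map_add_of_norm_cauchy_difference_le hp hf
    have h2 : (2 : ℝ) ^ p < 1 := Real.rpow_lt_one_of_one_lt_of_neg one_lt_two hp
    have hden : (0 : ℝ) < 2 - 2 ^ p := by linarith
    refine ⟨f, ⟨hadd, fun x _ => ?_⟩, ?_⟩
    · rw [sub_self, norm_zero]
      positivity
    · rintro T ⟨hT, hfT⟩
      funext x
      have h := eq_zero_of_map_add_of_norm_le_rpow (S := fun x => f x - T x) hp
        (fun x y => by simp only [hadd x y, hT x y]; abel) hfT x
      exact (sub_eq_zero.mp h).symm
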